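/- For every shape parameter ε > 0 and every dimension p ≥ 1, the Gaussian kernel K(x,y) = exp(−ε² ‖x − y‖₂²) on ℝ^p is strictly positive definite: for every N ∈ ℕ, every choice of N pairwise distinct points x_1, …, x_N ∈ ℝ^p, and every nonzero vector c ∈ ℝ^N, it holds that Σ_{i=1}^N Σ_{j=1}^N c_i c_j exp(−ε² ‖x_i − x_j‖₂²) > 0; equivalently, the matrix with entries exp(−ε² ‖x_i − x_j‖₂²) is symmetric positive definite. -/

import Mathlib

section GaussianKernel

open MeasureTheory

variable {V : Type*} [NormedAddCommGroup V] [InnerProductSpace ℝ V]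

theorem linearIndependent_exp_mul_inner {ι : Type*} {a : ℝ} (ha : a ≠ 0) {x : ι → V}
    (hx : Function.Injective x) :
    LinearIndependent ℝ (fun i (t : V) => Real.exp (a * inner ℝ t (x i))) := by
  let χ : ι → Multiplicative V →* ℝ := fun i =>
    { toFun := fun t => Real.exp (a * inner ℝ t.toAdd (x i))
      map_one' := by simp
      map_mul' := fun s t => by simp [inner_add_left, mul_add, Real.exp_add] }
  refine (linearIndependent_monoidHom (Multiplicative V) ℝ).comp χ fun i j hij => hx ?_
  refine ext_inner_left ℝ fun t => ?_
  have h : Real.exp (a * inner ℝ t (x i)) = Real.exp (a * inner ℝ t (x j)) :=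
    DFunLike.congr_fun hij (Multiplicative.ofAdd t)
  exact mul_left_cancel₀ ha (Real.exp_injective h)

/-- Translates of a Gaussian at distinct points are linearly independent. -/
theorem linearIndependent_gaussian_translates {ι : Type*} [Fintype ι] {b : ℝ} (hb : b ≠ 0)
    {x : ι → V} (hx : Function.Injective x) :
    LinearIndependent ℝ (fun i (t : V) => Real.exp (-b * ‖t - x i‖ ^ 2)) := by
  rw [Fintype.linearIndependent_iff]
  intro c hc i
  have key := Fintype.linearIndependent_iff.1
    (linearIndependent_exp_mul_inner (mul_ne_zero two_ne_zero hb) hx)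
    (fun j => c j * Real.exp (-b * ‖x j‖ ^ 2)) ?_ i
  · exact (mul_eq_zero.1 key).resolve_right (Real.exp_ne_zero _)
  funext t
  have h : ∑ j, c j * Real.exp (-b * ‖t - x j‖ ^ 2) = 0 := by simpa using congrFun hc t
  have hsplit (j : ι) : c j * Real.exp (-b * ‖t - x j‖ ^ 2) = Real.exp (-b * ‖t‖ ^ 2) *
      (c j * Real.exp (-b * ‖x j‖ ^ 2) * Real.exp (2 * b * inner ℝ t (x j))) := by
    have hexp : -b * ‖t - x j‖ ^ 2 =
        -b * ‖t‖ ^ 2 + (-b * ‖x j‖ ^ 2 + 2 * b * inner ℝ t (x j)) := by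
      rw [norm_sub_sq_real]
      ring
    rw [hexp, Real.exp_add, Real.exp_add]
    ring
  simp_rw [hsplit, ← Finset.mul_sum] at h
  simpa using (mul_eq_zero.1 h).resolve_left (Real.exp_ne_zero _)

theorem gaussian_mul_gaussian (b : ℝ) (x y t : V) :
    Real.exp (-(2 * b) * ‖t - x‖ ^ 2) * Real.exp (-(2 * b) * ‖t - y‖ ^ 2) =
      Real.exp (-b * ‖x - y‖ ^ 2) * Real.exp (-(4 * b) * ‖t - midpoint ℝ x y‖ ^ 2) := by
  have hsum : (t - x) + (t - y) = (2 : ℝ) • (t - midpoint ℝ x y) := by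
    rw [midpoint_eq_smul_add, smul_sub, smul_smul]
    simp only [invOf_eq_inv, mul_inv_cancel₀ (two_ne_zero' ℝ), one_smul, two_smul]
    abel
  have hpar := parallelogram_law_with_norm ℝ (t - x) (t - y)
  rw [hsum, sub_sub_sub_cancel_left, norm_smul, norm_sub_rev y x] at hpar
  norm_num at hpar
  rw [← Real.exp_add, ← Real.exp_add]
  congr 1
  linear_combination b * hpar

variable [FiniteDimensional ℝ V] [MeasurableSpace V] [BorelSpace V]

theorem integrable_exp_neg_mul_sq_norm {b : ℝ} (hb : 0 < b) :
    Integrable (fun v : V => Real.exp (-b * ‖v‖ ^ 2)) := by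
  have h := (GaussianFourier.integrable_cexp_neg_mul_sq_norm_add (V := V) (b := b)
    (by simpa using hb) 0 0).norm
  simpa [Complex.norm_exp, ← Complex.ofReal_pow] using h

theorem integrable_gaussian_mul_gaussian {b : ℝ} (hb : 0 < b) (x y : V) :
    Integrable fun t : V =>
      Real.exp (-(2 * b) * ‖t - x‖ ^ 2) * Real.exp (-(2 * b) * ‖t - y‖ ^ 2) := by
  simp_rw [gaussian_mul_gaussian]
  exact ((integrable_exp_neg_mul_sq_norm (by positivity)).comp_sub_right _).const_mul _

theorem integral_gaussian_mul_gaussian (b : ℝ) (x y : V) :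
    ∫ t : V, Real.exp (-(2 * b) * ‖t - x‖ ^ 2) * Real.exp (-(2 * b) * ‖t - y‖ ^ 2) =
      Real.exp (-b * ‖x - y‖ ^ 2) * ∫ t : V, Real.exp (-(4 * b) * ‖t‖ ^ 2) := by
  simp_rw [gaussian_mul_gaussian]
  rw [integral_const_mul,
    integral_sub_right_eq_self (fun t : V => Real.exp (-(4 * b) * ‖t‖ ^ 2))]

theorem sum_mul_gaussian_pos {ι : Type*} [Fintype ι] {b : ℝ} (hb : 0 < b) {x : ι → V}
    (hx : Function.Injective x) {c : ι → ℝ} (hc : c ≠ 0) :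
    0 < ∑ i, ∑ j, c i * c j * Real.exp (-b * ‖x i - x j‖ ^ 2) := by
  set g : ι → V → ℝ := fun i t => Real.exp (-(2 * b) * ‖t - x i‖ ^ 2) with hg
  have hsq (t : V) : (∑ i, c i * g i t) ^ 2 = ∑ i, ∑ j, c i * c j * (g i t * g j t) := by
    rw [sq, Finset.sum_mul_sum]
    exact Finset.sum_congr rfl fun i _ => Finset.sum_congr rfl fun j _ => by ring
  have hint (i j : ι) : Integrable fun t => c i * c j * (g i t * g j t) :=
    (integrable_gaussian_mul_gaussian hb (x i) (x j)).const_mul _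
  have hcont : Continuous fun t => (∑ i, c i * g i t) ^ 2 := by
    simp only [hg]
    fun_prop
  obtain ⟨t, ht⟩ : ∃ t, ∑ i, c i * g i t ≠ 0 := by
    by_contra! h
    refine hc (funext (Fintype.linearIndependent_iff.1
      (linearIndependent_gaussian_translates (mul_pos two_pos hb).ne' hx) c ?_))
    funext t
    simpa [hg] using h t
  have hpos : 0 < ∫ t, (∑ i, c i * g i t) ^ 2 := by
    refine integral_pos_of_integrable_nonneg_nonzero hcont ?_ (fun s => sq_nonneg _)
      (pow_ne_zero 2 ht)
    simp_rw [hsq]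
    exact integrable_finsetSum _ fun i _ => integrable_finsetSum _ fun j _ => hint i j
  have heq : ∫ t, (∑ i, c i * g i t) ^ 2 =
      (∑ i, ∑ j, c i * c j * Real.exp (-b * ‖x i - x j‖ ^ 2)) *
        ∫ t : V, Real.exp (-(4 * b) * ‖t‖ ^ 2) := by
    simp_rw [hsq, Finset.sum_mul]
    rw [integral_finsetSum _ fun i _ => integrable_finsetSum _ fun j _ => hint i j]
    refine Finset.sum_congr rfl fun i _ => ?_
    rw [integral_finsetSum _ fun j _ => hint i j]
    refine Finset.sum_congr rfl fun j _ => ?_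
    rw [integral_const_mul, integral_gaussian_mul_gaussian, mul_assoc (c i * c j)]
  rw [heq] at hpos
  exact pos_of_mul_pos_left hpos (integral_nonneg fun t => (Real.exp_pos _).le)

end GaussianKernel

/-- The Gaussian kernel `K(x,y) = exp(-ε² ‖x-y‖₂²)` on `ℝ^p`
(`ε > 0`, `p ≥ 1`) is strictly positive definite: for every `N`, every family of
`N` pairwise distinct points `x_1,…,x_N ∈ ℝ^p` and every nonzero `c ∈ ℝ^N`,
`Σ_i Σ_j c_i c_j exp(-ε² ‖x_i - x_j‖₂²) > 0`; equivalently, the kernel matrix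
`(exp(-ε² ‖x_i - x_j‖₂²))_{ij}` is (symmetric) positive definite. -/
theorem gaussian_kernel_strictly_positive_definite
    (p : ℕ) (hp : 1 ≤ p) (ε : ℝ) (hε : 0 < ε)
    (N : ℕ) (x : Fin N → EuclideanSpace ℝ (Fin p))
    (hx : Function.Injective x) :
    (∀ c : Fin N → ℝ, c ≠ 0 →
      0 < ∑ i, ∑ j, c i * c j * Real.exp (-(ε ^ 2) * ‖x i - x j‖ ^ 2)) ∧
    (Matrix.of fun i j => Real.exp (-(ε ^ 2) * ‖x i - x j‖ ^ 2)).PosDef := by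
  have hpos (c : Fin N → ℝ) (hc : c ≠ 0) :
      0 < ∑ i, ∑ j, c i * c j * Real.exp (-(ε ^ 2) * ‖x i - x j‖ ^ 2) :=
    sum_mul_gaussian_pos (pow_pos hε 2) hx hc
  refine ⟨hpos, .of_dotProduct_mulVec_pos ?_ fun c hc => ?_⟩
  · ext i j
    simp [norm_sub_rev (x j) (x i)]
  · refine (hpos c hc).trans_eq ?_
    simp only [dotProduct, Matrix.mulVec, Matrix.of_apply, star_trivial, Finset.mul_sum]
    exact Finset.sum_congr rfl fun i _ => Finset.sum_congr rfl fun j _ => by ring
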